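/- Let f be a non-constant Boolean function with s_1(f) = 2 and s_0(f) ≤ 6. Then C_0(f) ≤ (3/2)·s_0(f). -/

import Mathlib

/-- The input `x` with its `i`-th coordinate flipped. -/
def flipCoord {n : ℕ} (x : Fin n → Bool) (i : Fin n) : Fin n → Bool :=
  Function.update x i (!(x i))

/-- The sensitivity `s(f, x)` of a Boolean function `f` on input `x`:
the number of coordinates whose flip changes the value of `f`. -/
def sensAt {n : ℕ} (f : (Fin n → Bool) → Bool) (x : Fin n → Bool) : ℕ :=
  (Finset.univ.filter fun i => f (flipCoord x i) ≠ f x).card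

/-- The `b`-sensitivity `s_b(f)`: the maximum of `s(f, x)` over inputs `x` with `f x = b`. -/
def bSens {n : ℕ} (f : (Fin n → Bool) → Bool) (b : Bool) : ℕ :=
  (Finset.univ.filter fun x => f x = b).sup (sensAt f)

/-- The certificate complexity `C(f, x)`: the minimum size of a set `P` of coordinates
such that fixing the coordinates in `P` to their values in `x` forces the value of `f`. -/
noncomputable def certAt {n : ℕ} (f : (Fin n → Bool) → Bool) (x : Fin n → Bool) : ℕ :=
  sInf {k | ∃ P : Finset (Fin n), P.card = k ∧
    ∀ y : Fin n → Bool, (∀ i ∈ P, y i = x i) → f y = f x}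

/-- The `b`-certificate complexity `C_b(f)`: the maximum of `C(f, x)` over `x` with `f x = b`. -/
noncomputable def bCert {n : ℕ} (f : (Fin n → Bool) → Bool) (b : Bool) : ℕ :=
  (Finset.univ.filter fun x => f x = b).sup (certAt f)

/-- A Boolean function is non-constant if it takes two different values. -/
def NonConstant {n : ℕ} (f : (Fin n → Bool) → Bool) : Prop :=
  ∃ x y, f x ≠ f y

theorem flipCoord_flipCoord {n : ℕ} (x : Fin n → Bool) (i : Fin n) :
    flipCoord (flipCoord x i) i = x := by
  ext j
  by_cases h : j = i <;> simp [flipCoord, h]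

theorem flipCoord_comm {n : ℕ} (x : Fin n → Bool) (i j : Fin n) :
    flipCoord (flipCoord x i) j = flipCoord (flipCoord x j) i := by
  ext k
  by_cases h : k = i <;> by_cases h' : k = j <;>
    simp only [flipCoord, Function.update_apply] <;> grind

theorem flipCoord_apply_of_ne {n : ℕ} (x : Fin n → Bool) {i j : Fin n} (h : j ≠ i) :
    flipCoord x i j = x j := by
  simp [flipCoord, h]

theorem flipCoord_apply_self {n : ℕ} (x : Fin n → Bool) (i : Fin n) :
    flipCoord x i i = !x i := by
  simp [flipCoord]

theorem eq_flipCoord {n : ℕ} {x y : Fin n → Bool} {i : Fin n} (h : x i ≠ y i)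
    (h' : ∀ j, j ≠ i → x j = y j) : x = flipCoord y i := by
  ext j
  by_cases hj : j = i
  · subst hj
    rw [flipCoord_apply_self]
    cases hx : x j <;> cases hy : y j <;> simp_all
  · rw [flipCoord_apply_of_ne _ hj, h' j hj]

theorem card_le_sensAt {n : ℕ} {f : (Fin n → Bool) → Bool} {x : Fin n → Bool}
    (T : Finset (Fin n)) (h : ∀ k ∈ T, f (flipCoord x k) ≠ f x) : T.card ≤ sensAt f x :=
  Finset.card_le_card fun k hk => by simpa using h k hk

theorem sensAt_le_bSens {n : ℕ} (f : (Fin n → Bool) → Bool) (x : Fin n → Bool) :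
    sensAt f x ≤ bSens f (f x) :=
  Finset.le_sup (f := sensAt f) (by simp)

/-- Every `1`-input of `g` is sensitive to at most one coordinate. -/
def AtMostOneSensitive {n : ℕ} (g : (Fin n → Bool) → Bool) : Prop :=
  ∀ y j k, g y = true → g (flipCoord y j) = false → g (flipCoord y k) = false → j = k

/-- `g` is a coordinate or the negation of a coordinate. -/
def IsLiteral {n : ℕ} (g : (Fin n → Bool) → Bool) : Prop :=
  ∃ k b, ∀ y, g y = true ↔ y k = b

/-- The coordinates to which a `0`-input `y` of `g` is sensitive. -/
def upCoords {n : ℕ} (g : (Fin n → Bool) → Bool) (y : Fin n → Bool) : Finset (Fin n) :=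
  Finset.univ.filter fun k => g (flipCoord y k) = true

theorem mem_upCoords {n : ℕ} {g : (Fin n → Bool) → Bool} {y : Fin n → Bool} {k : Fin n} :
    k ∈ upCoords g y ↔ g (flipCoord y k) = true := by
  simp [upCoords]

namespace AtMostOneSensitive

variable {n : ℕ} {g : (Fin n → Bool) → Bool}

theorem flip_flip_eq_true (hg : AtMostOneSensitive g) {z : Fin n → Bool} {j a : Fin n}
    (hz : g z = false) (hj : g (flipCoord z j) = false) (ha : g (flipCoord z a) = true) :
    g (flipCoord (flipCoord z j) a) = true := by
  by_contra hcon
  have hja := hg (flipCoord z a) j a ha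
    (by rw [flipCoord_comm]; simpa using hcon) (by rw [flipCoord_flipCoord]; exact hz)
  subst hja
  simp_all

theorem upCoords_flip (hg : AtMostOneSensitive g) {z : Fin n → Bool} {j : Fin n}
    (hz : g z = false) (hj : g (flipCoord z j) = false) :
    upCoords g (flipCoord z j) = upCoords g z := by
  ext a
  simp only [mem_upCoords]
  refine ⟨fun h => ?_, hg.flip_flip_eq_true hz hj⟩
  have := hg.flip_flip_eq_true (j := j) hj (by rw [flipCoord_flipCoord]; exact hz) h
  rwa [flipCoord_flipCoord] at this

theorem eq_false_of_agree (hg : AtMostOneSensitive g) {z : Fin n → Bool} (hz : g z = false)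
    (w : Fin n → Bool) (hw : ∀ k ∈ upCoords g z, w k = z k) :
    g w = false ∧ upCoords g w = upCoords g z := by
  induction hm : (Finset.univ.filter fun k => w k ≠ z k).card generalizing w with
  | zero =>
    have : w = z := by
      ext k
      simpa using (Finset.filter_eq_empty_iff.mp (Finset.card_eq_zero.mp hm)) (Finset.mem_univ k)
    subst this
    exact ⟨hz, rfl⟩
  | succ m ih =>
    obtain ⟨j, hj⟩ := Finset.card_pos.mp (by omega :
      0 < (Finset.univ.filter fun k => w k ≠ z k).card)
    have hjw : w j ≠ z j := by simpa using hj
    have hset : (Finset.univ.filter fun k => flipCoord w j k ≠ z k) =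
        (Finset.univ.filter fun k => w k ≠ z k).erase j := by
      ext k
      by_cases hk : k = j
      · subst hk
        simp only [Finset.mem_filter, Finset.mem_univ, true_and, Finset.mem_erase,
          flipCoord_apply_self]
        cases hx : w k <;> cases hy : z k <;> simp_all
      · simp [hk, flipCoord_apply_of_ne]
    obtain ⟨h0, h1⟩ := ih (flipCoord w j)
      (fun k hk => by
        have hkj : k ≠ j := by
          rintro rfl
          exact hjw (hw k hk)
        rw [flipCoord_apply_of_ne _ hkj]
        exact hw k hk)
      (by rw [hset, Finset.card_erase_of_mem hj]; omega)
    have hj' : g (flipCoord (flipCoord w j) j) = false := by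
      have : j ∉ upCoords g (flipCoord w j) := by
        rw [h1]
        exact fun h => hjw (hw j h)
      simpa [mem_upCoords] using this
    have h2 := hg.upCoords_flip h0 hj'
    rw [flipCoord_flipCoord] at hj' h2
    exact ⟨hj', h2.trans h1⟩

theorem upCoords_nonempty (hg : AtMostOneSensitive g) (hne : ∃ y, g y = true)
    {z : Fin n → Bool} (hz : g z = false) : (upCoords g z).Nonempty := by
  by_contra hcon
  rw [Finset.not_nonempty_iff_eq_empty] at hcon
  obtain ⟨y, hy⟩ := hne
  have := (hg.eq_false_of_agree hz y (by simp [hcon])).1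
  simp_all

theorem isLiteral_of_upCoords_eq (hg : AtMostOneSensitive g) {z : Fin n → Bool}
    (hz : g z = false) {k : Fin n} (hk : upCoords g z = {k}) : IsLiteral g := by
  have key : ∀ w, w k = z k → g w = false ∧ upCoords g w = {k} := fun w hw => by
    have := hg.eq_false_of_agree hz w (by simpa [hk] using hw)
    exact ⟨this.1, this.2.trans hk⟩
  refine ⟨k, !z k, fun y => ⟨fun hy => ?_, fun hy => ?_⟩⟩
  · by_contra hcon
    have := (key y (by cases h : y k <;> cases h' : z k <;> simp_all)).1
    simp_all
  · have h := (key (flipCoord y k) (by rw [flipCoord_apply_self, hy, Bool.not_not])).2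
    have : k ∈ upCoords g (flipCoord y k) := by simp [h]
    rwa [mem_upCoords, flipCoord_flipCoord] at this

theorem two_le_card_upCoords (hg : AtMostOneSensitive g) (hne : ∃ y, g y = true)
    (hlit : ¬ IsLiteral g) {z : Fin n → Bool} (hz : g z = false) :
    2 ≤ (upCoords g z).card := by
  have h1 := (hg.upCoords_nonempty hne hz).card_pos
  have h2 : (upCoords g z).card ≠ 1 := fun h => by
    obtain ⟨k, hk⟩ := Finset.card_eq_one.mp h
    exact hlit (hg.isLiteral_of_upCoords_eq hz hk)
  omega

theorem three_mul_card_lt (hg : AtMostOneSensitive g) (hne : ∃ y, g y = true)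
    (hlit : ¬ IsLiteral g) :
    3 * (Finset.univ.filter fun y => g y = false).card < 2 ^ n := by
  set Z := Finset.univ.filter fun y => g y = false with hZ
  set Y := Finset.univ.filter fun y => ¬ g y = false with hY
  have htot : Z.card + Y.card = 2 ^ n := by
    rw [hZ, hY, Finset.card_filter_add_card_filter_not]
    simp
  have hle : (Z.sigma fun z => upCoords g z).card ≤ Y.card := by
    refine Finset.card_le_card_of_injOn (fun p => flipCoord p.1 p.2) ?_ ?_
    · rintro ⟨z, k⟩ h
      simp only [Finset.coe_sigma, Set.mem_sigma_iff, Finset.mem_coe, mem_upCoords] at h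
      simp [hY, h.2]
    · rintro ⟨z, k⟩ h ⟨z', k'⟩ h' heq
      simp only [Finset.coe_sigma, Set.mem_sigma_iff, Finset.mem_coe, mem_upCoords] at h h'
      simp only at heq
      have hz : g z = false := by simpa [hZ] using h.1
      have hz' : g z' = false := by simpa [hZ] using h'.1
      have hk : k = k' := hg (flipCoord z k) k k' h.2
        (by rw [flipCoord_flipCoord]; exact hz) (by rw [heq, flipCoord_flipCoord]; exact hz')
      subst hk
      have : z = z' := by rw [← flipCoord_flipCoord z k, heq, flipCoord_flipCoord]
      subst this
      rfl
  rw [Finset.card_sigma] at hle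
  have h2 : Z.card * 2 ≤ ∑ z ∈ Z, (upCoords g z).card := by
    rw [← smul_eq_mul]
    exact Finset.card_nsmul_le_sum _ _ _ fun z hz =>
      hg.two_le_card_upCoords hne hlit (by simpa [hZ] using hz)
  have hne3 : 3 * Z.card ≠ 2 ^ n := fun h => by
    have : 3 ∣ 2 ^ n := ⟨_, h.symm⟩
    have := Nat.Prime.dvd_of_dvd_pow (by norm_num : Nat.Prime 3) this
    omega
  omega

end AtMostOneSensitive

theorem eq_of_sensAt_le_two {n : ℕ} {f : (Fin n → Bool) → Bool} {x : Fin n → Bool}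
    (hs : sensAt f x ≤ 2) (hx : f x = true) {a b c : Fin n} (ha : f (flipCoord x a) = false)
    (hb : f (flipCoord x b) = false) (hc : f (flipCoord x c) = false) (hab : a ≠ b)
    (hac : a ≠ c) : b = c := by
  by_contra hbc
  have h := card_le_sensAt (f := f) (x := x) {a, b, c} (by simp [hx, ha, hb, hc])
  rw [Finset.card_eq_three.mpr ⟨a, b, c, hab, hac, hbc, rfl⟩] at h
  omega

/-- Overwrite `y` by `z` on the coordinates in `P`. -/
def overwrite {n : ℕ} (z : Fin n → Bool) (P : Finset (Fin n)) (y : Fin n → Bool) :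
    Fin n → Bool :=
  fun j => if j ∈ P then z j else y j

/-- The restriction of `f` to the inputs differing from `z` on `P` exactly in coordinate `i`. -/
def slice {n : ℕ} (f : (Fin n → Bool) → Bool) (z : Fin n → Bool) (P : Finset (Fin n))
    (i : Fin n) (y : Fin n → Bool) : Bool :=
  f (flipCoord (overwrite z P y) i)

/-- The coordinates of `P` whose slice is not a literal. -/
noncomputable def nonLiterals {n : ℕ} (f : (Fin n → Bool) → Bool) (z : Fin n → Bool)
    (P : Finset (Fin n)) : Finset (Fin n) :=
  haveI := Classical.decPred fun i => IsLiteral (slice f z P i)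
  P.filter fun i => ¬ IsLiteral (slice f z P i)

theorem mem_nonLiterals {n : ℕ} {f : (Fin n → Bool) → Bool} {z : Fin n → Bool}
    {P : Finset (Fin n)} {i : Fin n} :
    i ∈ nonLiterals f z P ↔ i ∈ P ∧ ¬ IsLiteral (slice f z P i) := by
  simp [nonLiterals]

section overwrite

variable {n : ℕ} {z y : Fin n → Bool} {P : Finset (Fin n)} {k : Fin n}

theorem overwrite_of_mem (h : k ∈ P) : overwrite z P y k = z k := by
  simp [overwrite, h]

theorem overwrite_of_notMem (h : k ∉ P) : overwrite z P y k = y k := by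
  simp [overwrite, h]

theorem overwrite_flipCoord_of_mem (h : k ∈ P) :
    overwrite z P (flipCoord y k) = overwrite z P y := by
  ext j
  by_cases hj : j ∈ P
  · simp [overwrite, hj]
  · rw [overwrite_of_notMem hj, overwrite_of_notMem hj, flipCoord_apply_of_ne]
    exact fun hjk => hj (hjk ▸ h)

theorem overwrite_flipCoord_of_notMem (h : k ∉ P) :
    overwrite z P (flipCoord y k) = flipCoord (overwrite z P y) k := by
  ext j
  by_cases hjk : j = k
  · subst hjk
    rw [overwrite_of_notMem h, flipCoord_apply_self, flipCoord_apply_self, overwrite_of_notMem h]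
  · rw [flipCoord_apply_of_ne _ hjk]
    simp [overwrite, flipCoord_apply_of_ne _ hjk]

theorem notMem_of_slice_ne {f : (Fin n → Bool) → Bool} {i : Fin n}
    (h : slice f z P i (flipCoord y k) ≠ slice f z P i y) : k ∉ P := fun hk =>
  h (by rw [slice, slice, overwrite_flipCoord_of_mem hk])

theorem slice_flipCoord {f : (Fin n → Bool) → Bool} {i : Fin n} (h : k ∉ P) :
    slice f z P i (flipCoord y k) = f (flipCoord (flipCoord (overwrite z P y) i) k) := by
  rw [slice, overwrite_flipCoord_of_notMem h, flipCoord_comm]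

end overwrite

/-- `P` is a minimum size certificate for the `0`-input `z` of a function `f` whose
`1`-sensitivity is at most `2` and whose `0`-sensitivity is at most `s`. -/
structure IsMinCert {n : ℕ} (f : (Fin n → Bool) → Bool) (s : ℕ) (z : Fin n → Bool)
    (P : Finset (Fin n)) : Prop where
  sens_true : ∀ x, f x = true → sensAt f x ≤ 2
  sens_false : ∀ x, f x = false → sensAt f x ≤ s
  cert : ∀ y, (∀ i ∈ P, y i = z i) → f y = false
  minimal : ∀ Q : Finset (Fin n), Q.card < P.card → ∃ y, (∀ i ∈ Q, y i = z i) ∧ f y = true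

namespace IsMinCert

variable {n : ℕ} {f : (Fin n → Bool) → Bool} {s : ℕ} {z : Fin n → Bool} {P : Finset (Fin n)}

theorem apply_overwrite (h : IsMinCert f s z P) (y : Fin n → Bool) :
    f (overwrite z P y) = false :=
  h.cert _ fun _ hi => overwrite_of_mem hi

theorem atMostOneSensitive (h : IsMinCert f s z P) {i : Fin n} (hi : i ∈ P) :
    AtMostOneSensitive (slice f z P i) := by
  intro y j k hy hj hk
  have hjP : j ∉ P := notMem_of_slice_ne (by rw [hj, hy]; simp)
  have hkP : k ∉ P := notMem_of_slice_ne (by rw [hk, hy]; simp)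
  rw [slice_flipCoord hjP] at hj
  rw [slice_flipCoord hkP] at hk
  exact eq_of_sensAt_le_two (h.sens_true _ hy) hy (a := i)
    (by rw [flipCoord_flipCoord]; exact h.apply_overwrite y) hj hk
    (fun e => hjP (e ▸ hi)) (fun e => hkP (e ▸ hi))

theorem exists_slice_eq_true (h : IsMinCert f s z P) {i : Fin n} (hi : i ∈ P) :
    ∃ y, slice f z P i y = true := by
  obtain ⟨y, hy, hfy⟩ := h.minimal (P.erase i) (Finset.card_erase_lt_of_mem hi)
  have hyi : y i ≠ z i := fun e => by
    have := h.cert y fun j hj => by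
      by_cases hji : j = i
      · rw [hji, e]
      · exact hy j (Finset.mem_erase.mpr ⟨hji, hj⟩)
    simp_all
  refine ⟨y, ?_⟩
  rw [slice, ← eq_flipCoord (x := y) (by rwa [overwrite_of_mem hi]) fun j hj => ?_]
  · exact hfy
  · by_cases hjP : j ∈ P
    · rw [overwrite_of_mem hjP, hy j (Finset.mem_erase.mpr ⟨hj, hjP⟩)]
    · rw [overwrite_of_notMem hjP]

theorem card_slice_eq_true_le (h : IsMinCert f s z P) (y : Fin n → Bool) :
    (P.filter fun i => slice f z P i y = true).card ≤ s :=
  (card_le_sensAt _ fun i hi => by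
    rw [h.apply_overwrite y]
    have : f (flipCoord (overwrite z P y) i) = true := (Finset.mem_filter.mp hi).2
    simp [this]).trans (h.sens_false _ (h.apply_overwrite y))

theorem eq_of_two_flips_eq_false (h : IsMinCert f s z P) {y : Fin n → Bool} {i j k : Fin n}
    (hy : slice f z P i y = true) (hji : j ≠ i) (hki : k ≠ i)
    (hj : f (flipCoord (flipCoord (overwrite z P y) i) j) = false)
    (hk : f (flipCoord (flipCoord (overwrite z P y) i) k) = false) : j = k :=
  eq_of_sensAt_le_two (h.sens_true _ hy) hy (a := i)
    (by rw [flipCoord_flipCoord]; exact h.apply_overwrite y) hj hk hji.symm hki.symm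

theorem exists_slice_flipCoord_eq_false {y : Fin n → Bool} {i : Fin n}
    (hlit : IsLiteral (slice f z P i)) (hy : slice f z P i y = true) :
    ∃ k ∉ P, slice f z P i (flipCoord y k) = false := by
  obtain ⟨k, b, hk⟩ := hlit
  have hf : slice f z P i (flipCoord y k) = false := by
    rw [Bool.eq_false_iff, Ne, hk, flipCoord_apply_self, (hk y).mp hy]
    simp
  exact ⟨k, notMem_of_slice_ne (by rw [hf, hy]; simp), hf⟩

theorem two_flips_eq_true (h : IsMinCert f s z P) {y : Fin n → Bool} {i j : Fin n}
    (hi : i ∈ P) (hlit : IsLiteral (slice f z P i)) (hy : slice f z P i y = true) (hj : j ∈ P)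
    (hji : j ≠ i) : f (flipCoord (flipCoord (overwrite z P y) i) j) = true := by
  obtain ⟨k, hkP, hk⟩ := exists_slice_flipCoord_eq_false hlit hy
  by_contra hcon
  rw [slice_flipCoord hkP] at hk
  have := h.eq_of_two_flips_eq_false hy hji (fun e : k = i => hkP (e ▸ hi))
    (by simpa using hcon) hk
  exact hkP (this ▸ hj)

theorem upCoords_disjoint {y : Fin n → Bool} {i k : Fin n}
    (hy : slice f z P i y = false) (hk : k ∈ upCoords (slice f z P i) y) : k ∉ P := by
  rw [mem_upCoords] at hk
  exact notMem_of_slice_ne (by rw [hk, hy]; simp)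

theorem card_upCoords_add_card_le (h : IsMinCert f s z P) {y : Fin n → Bool} {i : Fin n}
    (hy : slice f z P i y = false) (T : Finset (Fin n)) (hTP : T ⊆ P)
    (hT : ∀ j ∈ T, f (flipCoord (flipCoord (overwrite z P y) i) j) = true) :
    (upCoords (slice f z P i) y).card + T.card ≤ s := by
  rw [← Finset.card_union_of_disjoint]
  · refine (card_le_sensAt _ fun k hk => ?_).trans (h.sens_false _ hy)
    have hy' : f (flipCoord (overwrite z P y) i) = false := hy
    rw [hy', Ne, Bool.not_eq_false]
    rcases Finset.mem_union.mp hk with hk | hk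
    · have hkP := upCoords_disjoint hy hk
      rw [mem_upCoords, slice_flipCoord hkP] at hk
      exact hk
    · exact hT k hk
  · exact Finset.disjoint_left.mpr fun k hk hkT => upCoords_disjoint hy hk (hTP hkT)

theorem le_card_upCoords (h : IsMinCert f s z P) {y : Fin n → Bool} {i : Fin n} (hi : i ∈ P)
    (hy : slice f z P i y = false) :
    1 + (if i ∈ nonLiterals f z P then 1 else 0) ≤ (upCoords (slice f z P i) y).card := by
  have hg := h.atMostOneSensitive hi
  have hne := h.exists_slice_eq_true hi
  split_ifs with hlit
  · exact hg.two_le_card_upCoords hne (mem_nonLiterals.mp hlit).2 hy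
  · exact (hg.upCoords_nonempty hne hy).card_pos

theorem card_slice_false_add_le (h : IsMinCert f s z P) (y : Fin n → Bool)
    (hy : (P.filter fun i => slice f z P i y = false).card + s = P.card) :
    (P.filter fun i => slice f z P i y = false).card +
      2 * ((nonLiterals f z P).filter fun i => slice f z P i y = false).card ≤
        (nonLiterals f z P).card := by
  set H := nonLiterals f z P with hH
  set U := P.filter fun i => slice f z P i y = false with hU
  set V := P.filter fun i => ¬ slice f z P i y = false with hV
  set p := overwrite z P y with hp
  have hUV : U.card + V.card = P.card := Finset.card_filter_add_card_filter_not _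
  let R : Fin n → Fin n → Prop := fun i j => f (flipCoord (flipCoord p i) j) = false
  have hleft : ∀ i ∈ U, 1 + (if i ∈ H then 1 else 0) ≤ (V.filter fun j => R i j).card := by
    intro i hi
    obtain ⟨hiP, hiy⟩ := Finset.mem_filter.mp hi
    have h1 := h.le_card_upCoords hiP hiy
    rw [← hH] at h1
    have h2 := h.card_upCoords_add_card_le hiy (V.filter fun j => ¬ R i j)
      ((Finset.filter_subset _ _).trans (Finset.filter_subset _ _))
      (fun j hj => by simpa [R] using (Finset.mem_filter.mp hj).2)
    have h3 := Finset.card_filter_add_card_filter_not (s := V) (fun j => R i j)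
    omega
  have hright : ∀ j ∈ V, (U.filter fun i => R i j).card ≤ if j ∈ H then 1 else 0 := by
    intro j hj
    obtain ⟨hjP, hjy⟩ := Finset.mem_filter.mp hj
    rw [Bool.not_eq_false] at hjy
    have hne : ∀ i ∈ U, i ≠ j := by
      rintro i hi rfl
      have := (Finset.mem_filter.mp hi).2
      simp_all
    split_ifs with hjH
    · refine Finset.card_le_one.mpr fun a ha b hb => ?_
      obtain ⟨haU, haR⟩ := Finset.mem_filter.mp ha
      obtain ⟨hbU, hbR⟩ := Finset.mem_filter.mp hb
      refine h.eq_of_two_flips_eq_false hjy (hne a haU) (hne b hbU) ?_ ?_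
      · rw [flipCoord_comm]; exact haR
      · rw [flipCoord_comm]; exact hbR
    · have hlit : IsLiteral (slice f z P j) := by
        by_contra hcon
        exact hjH (mem_nonLiterals.mpr ⟨hjP, hcon⟩)
      rw [Nat.le_zero, Finset.card_eq_zero, Finset.filter_eq_empty_iff]
      intro i hi hR
      have := h.two_flips_eq_true hjP hlit hjy (Finset.mem_filter.mp hi).1 (hne i hi)
      rw [flipCoord_comm] at this
      simp only [R, ← hp] at hR this
      simp_all
  have hdouble : ∑ i ∈ U, (V.filter fun j => R i j).card =
      ∑ j ∈ V, (U.filter fun i => R i j).card :=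
    Finset.sum_card_bipartiteAbove_eq_sum_card_bipartiteBelow R
  have h1 := Finset.sum_le_sum hleft
  have h2 := Finset.sum_le_sum hright
  rw [hdouble, Finset.sum_add_distrib, ← Finset.card_filter, Finset.sum_const, smul_eq_mul,
    mul_one] at h1
  rw [← Finset.card_filter] at h2
  have hHP : ∀ i ∈ H, i ∈ P := fun i hi => (mem_nonLiterals.mp hi).1
  have h3 : U.filter (· ∈ H) = H.filter fun i => slice f z P i y = false := by
    ext i
    simp only [hU, Finset.mem_filter]
    exact ⟨fun hi => ⟨hi.2, hi.1.2⟩, fun hi => ⟨⟨hHP i hi.1, hi.2⟩, hi.1⟩⟩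
  have h4 : V.filter (· ∈ H) = H.filter fun i => ¬ slice f z P i y = false := by
    ext i
    simp only [hV, Finset.mem_filter]
    exact ⟨fun hi => ⟨hi.2, hi.1.2⟩, fun hi => ⟨⟨hHP i hi.1, hi.2⟩, hi.1⟩⟩
  rw [h3] at h1
  rw [h4] at h2
  have h5 := Finset.card_filter_add_card_filter_not (s := H) (fun i => slice f z P i y = false)
  omega

end IsMinCert

namespace IsMinCert

variable {n : ℕ} {f : (Fin n → Bool) → Bool} {s : ℕ} {z : Fin n → Bool} {P : Finset (Fin n)}

theorem two_flips_eq_false (h : IsMinCert f s z P) (hlit : ∀ i ∈ P, IsLiteral (slice f z P i))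
    {y : Fin n → Bool} (hs : s ≤ (P.filter fun i => slice f z P i y = true).card + 1)
    {i j : Fin n} (hi : i ∈ P) (hj : j ∈ P) (hij : i ≠ j) (hiy : slice f z P i y = false)
    (hjy : slice f z P j y = false) :
    f (flipCoord (flipCoord (overwrite z P y) i) j) = false := by
  by_contra hcon
  have hjT : j ∉ P.filter fun i => slice f z P i y = true := by simp [hjy]
  have h1 := (h.le_card_upCoords hi hiy)
  have h2 := h.card_upCoords_add_card_le hiy
    (insert j (P.filter fun i => slice f z P i y = true))
    (Finset.insert_subset hj (Finset.filter_subset _ _)) (fun k hk => by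
      rcases Finset.mem_insert.mp hk with rfl | hk
      · simpa using hcon
      · obtain ⟨hkP, hky⟩ := Finset.mem_filter.mp hk
        have hik : i ≠ k := by
          rintro rfl
          simp_all
        rw [flipCoord_comm]
        exact h.two_flips_eq_true hkP (hlit k hkP) hky hi hik)
  rw [Finset.card_insert_of_notMem hjT] at h2
  omega

theorem three_flips_eq_true (h : IsMinCert f s z P)
    (hlit : ∀ i ∈ P, IsLiteral (slice f z P i))
    (hs : ∀ y, s ≤ (P.filter fun i => slice f z P i y = true).card + 1)
    {k : Fin n → Fin n} {b : Fin n → Bool}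
    (hkb : ∀ i ∈ P, ∀ y, slice f z P i y = true ↔ y (k i) = b i)
    {y : Fin n → Bool} {i j m : Fin n} (hi : i ∈ P) (hj : j ∈ P) (hm : m ∈ P)
    (hiy : slice f z P i y = false) (hjy : slice f z P j y = false)
    (hmy : slice f z P m y = true) (hkm : k m ≠ k i) :
    f (flipCoord (flipCoord (flipCoord (overwrite z P y) i) j) m) = true := by
  have him : i ≠ m := by
    rintro rfl
    simp_all
  have hjm : j ≠ m := by
    rintro rfl
    simp_all
  have hmf : slice f z P m (flipCoord y (k m)) = false := by
    rw [Bool.eq_false_iff, Ne, hkb m hm, flipCoord_apply_self, (hkb m hm y).mp hmy]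
    simp
  have hif : slice f z P i (flipCoord y (k m)) = false := by
    rw [Bool.eq_false_iff, Ne, hkb i hi, flipCoord_apply_of_ne _ hkm.symm, ← hkb i hi]
    simp [hiy]
  have hkP : k m ∉ P := notMem_of_slice_ne (by rw [hmf, hmy]; simp)
  have hx : f (flipCoord (flipCoord (overwrite z P y) i) m) = true := by
    rw [flipCoord_comm]
    exact h.two_flips_eq_true hm (hlit m hm) hmy hi him
  rw [flipCoord_comm (flipCoord _ _)]
  by_contra hcon
  have := eq_of_sensAt_le_two (h.sens_true _ hx) hx (a := m) (b := j) (c := k m)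
    (by rw [flipCoord_flipCoord]; exact hiy) (by simpa using hcon)
    (by
      have := h.two_flips_eq_false hlit (hs _) hi hm him hif hmf
      rwa [overwrite_flipCoord_of_notMem hkP, flipCoord_comm _ (k m) i,
        flipCoord_comm _ (k m) m] at this)
    hjm.symm (fun e => hkP (e ▸ hm))
  exact hkP (this ▸ hj)

theorem literal_coord_eq (h : IsMinCert f s z P)
    (hlit : ∀ i ∈ P, IsLiteral (slice f z P i))
    (hs : ∀ y, s ≤ (P.filter fun i => slice f z P i y = true).card + 1)
    {k : Fin n → Fin n} {b : Fin n → Bool}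
    (hkb : ∀ i ∈ P, ∀ y, slice f z P i y = true ↔ y (k i) = b i)
    {i j : Fin n} (hi : i ∈ P) (hj : j ∈ P) : k i = k j := by
  by_contra hk
  have hij : i ≠ j := fun e => hk (e ▸ rfl)
  obtain ⟨y, hyi, hyj⟩ : ∃ y : Fin n → Bool, y (k i) = !b i ∧ y (k j) = !b j :=
    ⟨fun m => if m = k i then !b i else !b j, by simp, by simp [Ne.symm hk]⟩
  have hiy : slice f z P i y = false := by
    rw [Bool.eq_false_iff, Ne, hkb i hi, hyi]
    simp
  have hjy : slice f z P j y = false := by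
    rw [Bool.eq_false_iff, Ne, hkb j hj, hyj]
    simp
  have hif : slice f z P i (flipCoord y (k i)) = true := by
    rw [hkb i hi, flipCoord_apply_self, hyi, Bool.not_not]
  have hjf : slice f z P j (flipCoord y (k j)) = true := by
    rw [hkb j hj, flipCoord_apply_self, hyj, Bool.not_not]
  have hkiP : k i ∉ P := notMem_of_slice_ne (by rw [hif, hiy]; simp)
  have hkjP : k j ∉ P := notMem_of_slice_ne (by rw [hjf, hjy]; simp)
  have hw := h.two_flips_eq_false hlit (hs y) hi hj hij hiy hjy
  set T := P.filter fun i => slice f z P i y = true with hT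
  have hTP : ∀ m, m ∉ P → m ∉ T := fun m hm hmT => hm (Finset.mem_filter.mp hmT).1
  have hcard : (insert (k i) (insert (k j) T)).card = T.card + 2 := by
    rw [Finset.card_insert_of_notMem, Finset.card_insert_of_notMem (hTP _ hkjP)]
    simp [hk, hTP _ hkiP]
  have hsens := (card_le_sensAt (f := f) (insert (k i) (insert (k j) T)) fun m hm => by
    rw [hw, Ne, Bool.not_eq_false]
    rcases Finset.mem_insert.mp hm with rfl | hm
    · have := h.two_flips_eq_true hi (hlit i hi) hif hj hij.symm
      rwa [overwrite_flipCoord_of_notMem hkiP, flipCoord_comm _ (k i) i,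
        flipCoord_comm _ (k i) j] at this
    rcases Finset.mem_insert.mp hm with rfl | hm
    · have := h.two_flips_eq_true hj (hlit j hj) hjf hi hij
      rwa [overwrite_flipCoord_of_notMem hkjP, flipCoord_comm _ (k j) j,
        flipCoord_comm _ (k j) i, flipCoord_comm _ j i] at this
    obtain ⟨hmP, hmy⟩ := Finset.mem_filter.mp hm
    by_cases hkm : k m = k i
    · rw [flipCoord_comm _ i j]
      exact h.three_flips_eq_true hlit hs hkb hj hi hmP hjy hiy hmy (hkm ▸ hk)
    · exact h.three_flips_eq_true hlit hs hkb hi hj hmP hiy hjy hmy hkm).trans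
        (h.sens_false _ hw)
  have hsy := hs y
  rw [← hT] at hsy
  omega

theorem apply_eq_false_of_agree (h : IsMinCert f s z P)
    (hlit : ∀ i ∈ P, IsLiteral (slice f z P i))
    (hs : ∀ y, s ≤ (P.filter fun i => slice f z P i y = true).card + 1)
    {k : Fin n} (hkP : k ∉ P) {b : Fin n → Bool}
    (hkb : ∀ i ∈ P, ∀ y, slice f z P i y = true ↔ y k = b i) (y : Fin n → Bool)
    (hyk : y k = z k) (hy : ∀ i ∈ P, slice f z P i z = true → y i = z i) : f y = false := by
  induction hm : (P.filter fun i => y i ≠ z i).card using Nat.strong_induction_on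
    generalizing y with
  | _ m ih =>
  set T := P.filter fun i => y i ≠ z i with hT
  have hTf : ∀ i ∈ T, slice f z P i y = false := fun i hi => by
    obtain ⟨hiP, hiy⟩ := Finset.mem_filter.mp hi
    rw [Bool.eq_false_iff, Ne, hkb i hiP, hyk, ← hkb i hiP]
    exact fun e => hiy (hy i hiP e)
  have hoff : ∀ i, i ∉ T → y i = overwrite z P y i := fun i hi => by
    by_cases hiP : i ∈ P
    · rw [overwrite_of_mem hiP]
      by_contra hne
      exact hi (Finset.mem_filter.mpr ⟨hiP, hne⟩)
    · rw [overwrite_of_notMem hiP]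
  have hon : ∀ i ∈ T, y i ≠ overwrite z P y i := fun i hi => by
    obtain ⟨hiP, hiy⟩ := Finset.mem_filter.mp hi
    rwa [overwrite_of_mem hiP]
  have hTP : ∀ i ∈ T, i ∈ P := fun i hi => (Finset.mem_filter.mp hi).1
  rcases (by omega : m = 0 ∨ m = 1 ∨ m = 2 ∨ 3 ≤ m) with h0 | h1 | h2 | h3
  · rw [h0, Finset.card_eq_zero] at hm
    have : y = overwrite z P y := funext fun i => hoff i (by simp [hm])
    rw [this]
    exact h.apply_overwrite y
  · rw [h1] at hm
    obtain ⟨i, hi⟩ := Finset.card_eq_one.mp hm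
    have : y = flipCoord (overwrite z P y) i :=
      eq_flipCoord (hon i (by simp [hi])) fun j hj => hoff j (by simp [hi, hj])
    rw [this]
    exact hTf i (by simp [hi])
  · rw [h2] at hm
    obtain ⟨i, j, hij, hT2⟩ := Finset.card_eq_two.mp hm
    have hiT : i ∈ T := by simp [hT2]
    have hjT : j ∈ T := by simp [hT2]
    have : y = flipCoord (flipCoord (overwrite z P y) i) j := by
      refine eq_flipCoord ?_ fun a ha => ?_
      · rw [flipCoord_apply_of_ne _ hij.symm]
        exact hon j hjT
      · by_cases hai : a = i
        · subst hai
          rw [flipCoord_apply_self]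
          exact Bool.eq_not_of_ne (hon a hiT)
        · rw [flipCoord_apply_of_ne _ hai]
          exact hoff a (by simp [hT2, hai, ha])
    rw [this]
    exact h.two_flips_eq_false hlit (hs y) (hTP i hiT) (hTP j hjT) hij (hTf i hiT) (hTf j hjT)
  · by_contra hcon
    rw [Bool.not_eq_false] at hcon
    have hle : T.card ≤ 2 := (card_le_sensAt T fun i hi => by
      have hiP := hTP i hi
      have hset : (P.filter fun j => flipCoord y i j ≠ z j) = T.erase i := by
        ext j
        by_cases hji : j = i
        · subst hji
          have := (Finset.mem_filter.mp hi).2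
          simp only [Finset.mem_filter, flipCoord_apply_self, Finset.mem_erase]
          cases hx : y j <;> cases hy : z j <;> simp_all
        · simp [hT, hji, flipCoord_apply_of_ne]
      rw [hcon, ih (m - 1) (by omega) (flipCoord y i) _ _ (by
        rw [hset, Finset.card_erase_of_mem hi, hm])]
      · simp
      · rw [flipCoord_apply_of_ne _ (fun e : k = i => hkP (e ▸ hiP)), hyk]
      · intro j hj hjz
        have hji : j ≠ i := by
          rintro rfl
          exact (Finset.mem_filter.mp hi).2 (hy j hj hjz)
        rw [flipCoord_apply_of_ne _ hji, hy j hj hjz]).trans (h.sens_true y hcon)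
    omega

theorem not_all_literals (h : IsMinCert f s z P) (hlit : ∀ i ∈ P, IsLiteral (slice f z P i))
    (hs : ∀ y, s ≤ (P.filter fun i => slice f z P i y = true).card + 1)
    (hz : (P.filter fun i => slice f z P i z = true).card + 1 < P.card) : False := by
  choose! k b hkb using hlit
  have hlit : ∀ i ∈ P, IsLiteral (slice f z P i) := fun i hi => ⟨k i, b i, hkb i hi⟩
  obtain ⟨i, hi⟩ := Finset.card_pos.mp (by omega : 0 < P.card)
  have hk : ∀ j ∈ P, k j = k i := fun j hj => h.literal_coord_eq hlit hs hkb hj hi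
  have hkP : k i ∉ P := by
    obtain ⟨y, hy⟩ := h.exists_slice_eq_true hi
    have : slice f z P i (flipCoord y (k i)) = false := by
      rw [Bool.eq_false_iff, Ne, hkb i hi, flipCoord_apply_self, (hkb i hi y).mp hy]
      simp
    exact notMem_of_slice_ne (y := y) (by rw [this, hy]; simp)
  obtain ⟨y, hy, hfy⟩ := h.minimal
    (insert (k i) (P.filter fun i => slice f z P i z = true))
    (lt_of_le_of_lt (Finset.card_insert_le _ _) hz)
  have := h.apply_eq_false_of_agree hlit hs hkP (b := b)
    (fun j hj y => by rw [hkb j hj, hk j hj]) y (hy _ (Finset.mem_insert_self _ _))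
    (fun j hj hjz => hy j (Finset.mem_insert_of_mem (Finset.mem_filter.mpr ⟨hj, hjz⟩)))
  simp_all

end IsMinCert

namespace IsMinCert

variable {n : ℕ} {f : (Fin n → Bool) → Bool} {s : ℕ} {z : Fin n → Bool} {P : Finset (Fin n)}

theorem slice_compl {i : Fin n} (hlit : IsLiteral (slice f z P i)) (y : Fin n → Bool) :
    slice f z P i yᶜ = !slice f z P i y := by
  obtain ⟨k, b, hkb⟩ := hlit
  have h1 := hkb y
  have h2 := hkb yᶜ
  simp only [Pi.compl_apply] at h2
  cases hy : y k <;> cases b <;> simp_all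

theorem three_mul_sum_card_lt (h : IsMinCert f s z P) (hne : (nonLiterals f z P).Nonempty) :
    3 * ∑ y, ((nonLiterals f z P).filter fun i => slice f z P i y = false).card <
      (nonLiterals f z P).card * 2 ^ n := by
  have hswap : ∑ y, ((nonLiterals f z P).filter fun i => slice f z P i y = false).card =
      ∑ i ∈ nonLiterals f z P, (Finset.univ.filter fun y => slice f z P i y = false).card :=
    Finset.sum_card_bipartiteAbove_eq_sum_card_bipartiteBelow _
  rw [hswap, Finset.mul_sum, ← smul_eq_mul, ← Finset.sum_const]
  refine Finset.sum_lt_sum_of_nonempty hne fun i hi => ?_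
  obtain ⟨hiP, hlit⟩ := mem_nonLiterals.mp hi
  exact (h.atMostOneSensitive hiP).three_mul_card_lt (h.exists_slice_eq_true hiP) hlit

theorem two_mul_card_le (h : IsMinCert f s z P) (hs : s ≤ 6) : 2 * P.card ≤ 3 * s := by
  by_contra! hcon
  set H := nonLiterals f z P with hH
  have hHP : H ⊆ P := fun i hi => (mem_nonLiterals.mp hi).1
  have hcard : (P \ H).card + H.card = P.card := Finset.card_sdiff_add_card_eq_card hHP
  let uL : (Fin n → Bool) → ℕ := fun y => ((P \ H).filter fun i => slice f z P i y = false).card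
  let uH : (Fin n → Bool) → ℕ := fun y => (H.filter fun i => slice f z P i y = false).card
  have hu : ∀ y, (P.filter fun i => slice f z P i y = false).card = uL y + uH y := fun y => by
    rw [← Finset.card_union_of_disjoint, ← Finset.filter_union, Finset.sdiff_union_of_subset hHP]
    exact Finset.disjoint_filter_filter Finset.sdiff_disjoint
  have htrue : ∀ y, (P.filter fun i => slice f z P i y = true).card + (uL y + uH y) = P.card :=
    fun y => by
      rw [← hu, ← Finset.card_filter_add_card_filter_not (s := P)
        (fun i => slice f z P i y = true)]
      simp only [Bool.not_eq_true]
  have hge : ∀ y, P.card ≤ s + (uL y + uH y) := fun y => by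
    have := htrue y
    have := h.card_slice_eq_true_le y
    omega
  have htight : ∀ y, uL y + uH y + s = P.card → uL y + uH y + 2 * uH y ≤ H.card := fun y hy => by
    have := h.card_slice_false_add_le y (by rw [hu, hy])
    rwa [hu] at this
  have hcompl : ∀ y, uL y + uL yᶜ = (P \ H).card := fun y => by
    have hlit : ∀ i ∈ P \ H, IsLiteral (slice f z P i) := fun i hi => by
      by_contra hni
      obtain ⟨hiP, hiH⟩ := Finset.mem_sdiff.mp hi
      exact hiH (mem_nonLiterals.mpr ⟨hiP, hni⟩)
    have : uL yᶜ = ((P \ H).filter fun i => ¬ slice f z P i y = false).card := by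
      refine congrArg Finset.card (Finset.filter_congr fun i hi => ?_)
      rw [slice_compl (hlit i hi)]
      simp
    rw [this]
    exact Finset.card_filter_add_card_filter_not _
  rcases H.eq_empty_or_nonempty with hempty | hne
  · have hH0 : H.card = 0 := by rw [hempty, Finset.card_empty]
    have hlit : ∀ i ∈ P, IsLiteral (slice f z P i) := fun i hi => by
      by_contra hni
      have : i ∈ H := mem_nonLiterals.mpr ⟨hi, hni⟩
      simp [hempty] at this
    have huH : ∀ y, uH y = 0 := fun y => by simp [uH, hempty]
    have key : ∀ y, uL y + 1 = s ∧ P.card = 2 * uL y ∧ 4 ≤ uL y := fun y => by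
      have h1 := hge y
      have h2 := hge yᶜ
      have h3 := htight y
      have h4 := htight yᶜ
      have h5 := hcompl y
      have h6 := huH y
      have h7 := huH yᶜ
      omega
    refine h.not_all_literals hlit (fun y => ?_) ?_
    · have := htrue y
      have := key y
      have := huH y
      omega
    · have := htrue z
      have := key z
      omega
  · have hpair : ∀ y, 2 * H.card ≤ 3 * (uH y + uH yᶜ) := fun y => by
      have h0 := hne.card_pos
      have h1 := hge y
      have h2 := hge yᶜ
      have h3 := htight y
      have h4 := htight yᶜ
      have h5 := hcompl y
      obtain ⟨D, hD⟩ : ∃ D, D + s = P.card := ⟨P.card - s, by omega⟩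
      omega
    have hsum := Finset.sum_le_sum fun y (_ : y ∈ Finset.univ) => hpair y
    have hinv : ∑ y, uH yᶜ = ∑ y, uH y :=
      Equiv.sum_comp (Function.Involutive.toPerm compl compl_involutive) uH
    have hlt := h.three_mul_sum_card_lt hne
    rw [← Finset.mul_sum, ← Finset.mul_sum, Finset.sum_add_distrib, hinv,
      Finset.sum_const, Finset.card_univ, Fintype.card_fun, Fintype.card_bool, Fintype.card_fin, smul_eq_mul] at hsum
    change 3 * ∑ y, uH y < H.card * 2 ^ n at hlt
    nlinarith

end IsMinCert

theorem exists_card_eq_certAt {n : ℕ} (f : (Fin n → Bool) → Bool) (x : Fin n → Bool) :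
    ∃ P : Finset (Fin n), P.card = certAt f x ∧
      ∀ y : Fin n → Bool, (∀ i ∈ P, y i = x i) → f y = f x :=
  Nat.sInf_mem (s := {k | ∃ P : Finset (Fin n), P.card = k ∧
    ∀ y : Fin n → Bool, (∀ i ∈ P, y i = x i) → f y = f x})
    ⟨_, Finset.univ, rfl, fun y hy => by rw [funext fun i => hy i (Finset.mem_univ i)]⟩

theorem certAt_le_card {n : ℕ} {f : (Fin n → Bool) → Bool} {x : Fin n → Bool}
    (P : Finset (Fin n)) (hP : ∀ y : Fin n → Bool, (∀ i ∈ P, y i = x i) → f y = f x) :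
    certAt f x ≤ P.card :=
  Nat.sInf_le ⟨P, rfl, hP⟩

theorem two_mul_certAt_le {n : ℕ} {f : (Fin n → Bool) → Bool} (hs1 : bSens f true ≤ 2)
    (hs0 : bSens f false ≤ 6) {z : Fin n → Bool} (hz : f z = false) :
    2 * certAt f z ≤ 3 * bSens f false := by
  obtain ⟨P, hcard, hP⟩ := exists_card_eq_certAt f z
  have h : IsMinCert f (bSens f false) z P :=
    { sens_true := fun x hx => (hx ▸ sensAt_le_bSens f x).trans hs1
      sens_false := fun x hx => hx ▸ sensAt_le_bSens f x
      cert := fun y hy => (hP y hy).trans hz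
      minimal := fun Q hQ => by
        by_contra! hcon
        have := certAt_le_card (f := f) (x := z) Q fun y hy => by
          rw [hz]
          simpa using hcon y hy
        omega }
  rw [← hcard]
  exact h.two_mul_card_le hs0

/-- If `f` is non-constant with `s₁(f) = 2` and `s₀(f) ≤ 6`, then `C₀(f) ≤ (3/2)·s₀(f)`. -/
theorem cert0_le_three_halves_sens0_of_sens0_le_six {n : ℕ} (f : (Fin n → Bool) → Bool)
    (hnc : NonConstant f) (hs1 : bSens f true = 2) (hs0 : bSens f false ≤ 6) :
    (bCert f false : ℚ) ≤ 3 / 2 * (bSens f false : ℚ) := by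
  have hle : bCert f false ≤ 3 * bSens f false / 2 := by
    refine Finset.sup_le fun z hz => ?_
    have := two_mul_certAt_le hs1.le hs0 (Finset.mem_filter.mp hz).2
    omega
  have h2 : 2 * bCert f false ≤ 3 * bSens f false := by omega
  have h3 : (2 * bCert f false : ℚ) ≤ 3 * bSens f false := by exact_mod_cast h2
  linarith
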